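/- arXiv:1102.2593 — 2 statements merged into one kernel-verified Lean document; each statement's English description precedes it below -/
import Mathlib

section
/- There exists an (8, 2^{12}+701, 4, 4)_2 constant dimension code, i.e., a set of 2^{12}+701 = 4797 four-dimensional subspaces of 𝔽_2^8 whose pairwise subspace distances are all at least 4, which contains an (8,4,2)_2 lifted MRD code as a subcode; in particular A_2(8,4,4) ≥ 4797, and this size attains the upper bound q^{(n−2k)(k+1)} + Gauss[n−2k,k]_q·(q^n−q^{n−2k})/(q^{2k}−q^k) + A_q(n−2k,2k,2k) for codes containing a lifted MRD code, at q=2, n=8, k=2. -/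
open Module Polynomial Matrix

variable (F : Type) [Field F] [Fintype F]

/-- `C` is a `[k × (n-k), (n-k)(k-δ+1), δ]_q` MRD (maximum rank distance) code:
an `F`-linear subspace of `k × (n-k)` matrices of dimension `(n-k)(k-δ+1)` in which
every nonzero matrix has rank at least `δ`. -/
def IsMRD (n k δ : ℕ) (C : Submodule F (Matrix (Fin k) (Fin (n - k)) F)) : Prop :=
  Module.finrank F C = (n - k) * (k - δ + 1) ∧
    ∀ A : Matrix (Fin k) (Fin (n - k)) F, A ∈ C → A ≠ 0 → δ ≤ A.rank

/-- The matrix `[I_k | A]`. -/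
def liftMatrix (n k : ℕ) (A : Matrix (Fin k) (Fin (n - k)) F) : Matrix (Fin k) (Fin n) F :=
  Matrix.of fun i j =>
    if h : (j : ℕ) < k then (if (i : ℕ) = (j : ℕ) then 1 else 0)
    else A i ⟨(j : ℕ) - k, by have := j.isLt; omega⟩

/-- The lifting of the matrix `A`: the row space of `[I_k | A]`, a subspace of `F^n`. -/
def liftSubspace (n k : ℕ) (A : Matrix (Fin k) (Fin (n - k)) F) : Submodule F (Fin n → F) :=
  Submodule.span F (Set.range fun i => liftMatrix F n k A i)

/-- The lifted code of a rank-metric code `C`: the set of liftings of all codewords of `C`. -/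
def liftedCode (n k : ℕ) (C : Submodule F (Matrix (Fin k) (Fin (n - k)) F)) :
    Set (Submodule F (Fin n → F)) :=
  {X | ∃ A ∈ C, X = liftSubspace F n k A}

/-- The subspace distance `d_S(X,Y) = dim X + dim Y - 2 dim (X ⊓ Y)`. -/
noncomputable def subDist {n : ℕ} (X Y : Submodule F (Fin n → F)) : ℕ :=
  finrank F X + finrank F Y - 2 * finrank F (X ⊓ Y : Submodule F (Fin n → F))

/-- `L^{(n,k)}`: vectors of `F^n` whose first `k` coordinates are not all zero. -/
def Lset (n k : ℕ) : Set (Fin n → F) := {v | ∃ i : Fin n, (i : ℕ) < k ∧ v i ≠ 0}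

/-- `V^n`: one-dimensional subspaces of `F^n` spanned by vectors of `L^{(n,k)}`. -/
def Vset (n k : ℕ) : Set (Submodule F (Fin n → F)) :=
  {X | ∃ v ∈ Lset F n k, X = Submodule.span F {v}}

/-- Projection of a vector of `F^n` onto its first `k` coordinates. -/
def projK (n k : ℕ) (v : Fin n → F) : Fin k → F :=
  fun i => if h : (i : ℕ) < n then v ⟨(i : ℕ), h⟩ else 0

/-- `V_A^{(n,k)}`: one-dimensional subspaces of `F^n` spanned by vectors whose projection
onto the first `k` coordinates is a nonzero vector spanning `A`. -/
def VA (n k : ℕ) (A : Submodule F (Fin k → F)) : Set (Submodule F (Fin n → F)) :=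
  {X | ∃ v : Fin n → F, projK F n k v ≠ 0 ∧ Submodule.span F {projK F n k v} = A ∧
    X = Submodule.span F {v}}

/-- `A_q(n,d,k)`: the maximum size of an `(n, M, d, k)_q` constant dimension code, i.e. of a
set of `k`-dimensional subspaces of `F^n` whose pairwise subspace distances are at least `d`. -/
noncomputable def Aq (n d k : ℕ) : ℕ :=
  sSup {M | ∃ S : Set (Submodule F (Fin n → F)), S.Finite ∧ S.ncard = M ∧
    (∀ X ∈ S, finrank F X = k) ∧ ∀ X ∈ S, ∀ Y ∈ S, X ≠ Y → d ≤ subDist F X Y}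

/-- The Gaussian coefficient `[n, k]_q`: the number of `k`-dimensional subspaces of `F^n`. -/
noncomputable def gaussNat (n k : ℕ) : ℕ :=
  Nat.card {X : Submodule F (Fin n → F) // finrank F X = k}

/-! ### Subspaces of a product given by a base, a fibre and a map -/

section Sheet

variable {k V W : Type*} [Field k] [AddCommGroup V] [Module k V] [AddCommGroup W] [Module k W]

/-- The subspace of `V × W` that projects onto `A`, meets `0 × W` in `B`, and lies over the graph
of `f` modulo `B`. -/
def sheet (A : Submodule k V) (B : Submodule k W) (f : V →ₗ[k] W) : Submodule k (V × W) :=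
  (A.prod B).comap
    (LinearEquiv.skewProd (LinearEquiv.refl k V) (LinearEquiv.refl k W) (-f)).toLinearMap

theorem mem_sheet {A : Submodule k V} {B : Submodule k W} {f : V →ₗ[k] W} {p : V × W} :
    p ∈ sheet A B f ↔ p.1 ∈ A ∧ p.2 - f p.1 ∈ B := by
  simp [sheet, Submodule.mem_prod, sub_eq_add_neg]

theorem finrank_le_add_of_fst_mem [FiniteDimensional k V] [FiniteDimensional k W]
    {P : Submodule k (V × W)} {A : Submodule k V} {B : Submodule k W}
    (hA : ∀ p ∈ P, p.1 ∈ A) (hB : ∀ w, (0, w) ∈ P → w ∈ B) :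
    finrank k P ≤ finrank k A + finrank k B := by
  let g : P →ₗ[k] V := (LinearMap.fst k V W).domRestrict P
  rw [← LinearMap.finrank_range_add_finrank_ker g]
  have mem_of_ker (p : LinearMap.ker g) : (0, p.1.1.2) ∈ P := by
    have h : p.1.1.1 = 0 := p.2
    rw [← h]
    exact p.1.2
  refine Nat.add_le_add (Submodule.finrank_mono ?_) ?_
  · rintro _ ⟨p, rfl⟩
    exact hA _ p.2
  · let h : LinearMap.ker g →ₗ[k] B := LinearMap.codRestrict B
      (LinearMap.snd k V W ∘ₗ P.subtype ∘ₗ (LinearMap.ker g).subtype)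
      fun p => hB _ (mem_of_ker p)
    refine LinearMap.finrank_le_finrank_of_injective (f := h) fun p q hpq => ?_
    have h₁ : p.1.1.1 = 0 := p.2
    have h₂ : q.1.1.1 = 0 := q.2
    exact Subtype.ext (Subtype.ext (Prod.ext (h₁.trans h₂.symm) (congrArg Subtype.val hpq)))

theorem finrank_sheet [FiniteDimensional k V] [FiniteDimensional k W]
    (A : Submodule k V) (B : Submodule k W) (f : V →ₗ[k] W) :
    finrank k (sheet A B f) = finrank k A + finrank k B := by
  refine le_antisymm (finrank_le_add_of_fst_mem (fun p hp => (mem_sheet.1 hp).1) fun w hw => by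
    simpa using (mem_sheet.1 hw).2) ?_
  rw [← Module.finrank_prod (R := k)]
  let h : A × B →ₗ[k] sheet A B f := LinearMap.codRestrict _
    ((A.subtype ∘ₗ LinearMap.fst k A B).prod
      (B.subtype ∘ₗ LinearMap.snd k A B + f ∘ₗ A.subtype ∘ₗ LinearMap.fst k A B))
    fun p => mem_sheet.2 ⟨p.1.2, by simp⟩
  refine LinearMap.finrank_le_finrank_of_injective (f := h) fun p q hpq => ?_
  obtain ⟨h₁, h₂⟩ := Prod.ext_iff.1 (congrArg Subtype.val hpq)
  have h₁ : p.1 = q.1 := Subtype.ext h₁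
  have h₂ : (p.2 : W) + f p.1 = q.2 + f q.1 := h₂
  rw [h₁, add_left_inj] at h₂
  exact Prod.ext h₁ (Subtype.ext h₂)

theorem finrank_sheet_inf_sheet_le [FiniteDimensional k V] [FiniteDimensional k W]
    (A A' : Submodule k V) (B B' : Submodule k W) (f f' : V →ₗ[k] W) :
    finrank k (sheet A B f ⊓ sheet A' B' f' : Submodule k (V × W)) ≤
      finrank k (A ⊓ A' ⊓ (B ⊔ B').comap (f - f') : Submodule k V) +
        finrank k (B ⊓ B' : Submodule k W) := by
  refine finrank_le_add_of_fst_mem ?_ ?_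
  · rintro p ⟨hp, hp'⟩
    obtain ⟨h₁, h₂⟩ := mem_sheet.1 hp
    obtain ⟨h₁', h₂'⟩ := mem_sheet.1 hp'
    refine ⟨⟨h₁, h₁'⟩, ?_⟩
    have h : (f - f') p.1 = -(p.2 - f p.1) + (p.2 - f' p.1) := by
      rw [LinearMap.sub_apply]
      abel
    rw [SetLike.mem_coe, Submodule.mem_comap, h]
    exact Submodule.add_mem_sup (neg_mem h₂) h₂'
  · rintro w ⟨hw, hw'⟩
    exact ⟨by simpa using (mem_sheet.1 hw).2, by simpa using (mem_sheet.1 hw').2⟩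

theorem finrank_sheet_inf_sheet_le_add [FiniteDimensional k V] [FiniteDimensional k W]
    (A A' : Submodule k V) (B B' : Submodule k W) (f f' : V →ₗ[k] W) :
    finrank k (sheet A B f ⊓ sheet A' B' f' : Submodule k (V × W)) ≤
      finrank k (A ⊓ A' : Submodule k V) + finrank k (B ⊓ B' : Submodule k W) :=
  (finrank_sheet_inf_sheet_le A A' B B' f f').trans
    (Nat.add_le_add_right (Submodule.finrank_mono inf_le_left) _)

theorem finrank_sheet_inf_sheet_le_right_add_left [FiniteDimensional k V] [FiniteDimensional k W]
    (A A' : Submodule k V) (B B' : Submodule k W) (f f' : V →ₗ[k] W) :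
    finrank k (sheet A B f ⊓ sheet A' B' f' : Submodule k (V × W)) ≤
      finrank k A' + finrank k B :=
  (finrank_sheet_inf_sheet_le_add A A' B B' f f').trans
    (Nat.add_le_add (Submodule.finrank_mono inf_le_right) (Submodule.finrank_mono inf_le_left))

/-- Transporting multiplication by the elements of an extension field gives maps whose pairwise
differences carry `A` injectively into a complement of `B`. -/
theorem exists_maps_inf_comap_sub_eq_bot (K : Type*) [Field K] [Algebra k K]
    [FiniteDimensional k K] [FiniteDimensional k V] [FiniteDimensional k W]
    {A : Submodule k V} {B : Submodule k W} (hA : finrank k A = finrank k K)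
    (hB : finrank k B + finrank k K = finrank k W) :
    ∃ f : K → V →ₗ[k] W, ∀ s t, s ≠ t → A ⊓ B.comap (f s - f t) = ⊥ := by
  obtain ⟨g, hg⟩ := LinearMap.exists_extend (LinearEquiv.ofFinrankEq A K hA).toLinearMap
  obtain ⟨B', hB'⟩ := Submodule.exists_isCompl B
  have hB'_finrank : finrank k K = finrank k B' := by
    have := Submodule.finrank_add_eq_of_isCompl hB'
    omega
  let e := LinearEquiv.ofFinrankEq K B' hB'_finrank
  refine ⟨fun t => B'.subtype ∘ₗ e.toLinearMap ∘ₗ LinearMap.mulLeft k t ∘ₗ g,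
    fun s t hst => (Submodule.eq_bot_iff _).2 ?_⟩
  rintro x ⟨hxA, hxB⟩
  have hgx : g x = LinearEquiv.ofFinrankEq A K hA ⟨x, hxA⟩ :=
    LinearMap.congr_fun hg ⟨x, hxA⟩
  have hx : ((e ((s - t) * g x) : B') : W) ∈ B := by
    simpa [sub_mul] using hxB
  have h₀ : e ((s - t) * g x) = 0 :=
    Subtype.ext (Submodule.disjoint_def.1 hB'.disjoint _ hx (e _).2)
  have h₁ : g x = 0 := by
    simpa [sub_ne_zero.2 hst] using h₀
  rw [hgx, LinearEquiv.map_eq_zero_iff] at h₁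
  exact congrArg Subtype.val h₁

end Sheet

/-! ### An MRD code with minimum rank distance two -/

section RankTwo

variable {k : Type*} [Field k] {m n : ℕ}

theorem exists_eq_vecMulVec_of_rank_le_one {A : Matrix (Fin m) (Fin n) k} (hA : A.rank ≤ 1) :
    ∃ u v, A = vecMulVec u v := by
  obtain ⟨u, hu⟩ := finrank_le_one_iff.1 hA
  choose v hv using fun j => hu ⟨A.mulVecLin (Pi.single j 1), LinearMap.mem_range_self _ _⟩
  refine ⟨u.1, v, Matrix.ext fun i j => ?_⟩
  have h := congrFun (congrArg Subtype.val (hv j)) i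
  simp only [Submodule.coe_smul, Pi.smul_apply, smul_eq_mul, mulVecLin_apply, mulVec_single_one,
    col_apply] at h
  rw [vecMulVec_apply, mul_comm, h]

variable {K : Type*} [Field K] [Algebra k K]

/-- The linear functional on matrices that sends `u vᵀ` to the product of the elements of `K` with
coordinates `u` and `v`. -/
noncomputable def productForm (b : Basis (Fin n) k K) : Matrix (Fin n) (Fin n) k →ₗ[k] K where
  toFun A := ∑ i, ∑ j, A i j • (b i * b j)
  map_add' A B := by simp [add_smul, Finset.sum_add_distrib]
  map_smul' c A := by simp [Finset.smul_sum, smul_smul]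

theorem productForm_vecMulVec (b : Basis (Fin n) k K) (u v : Fin n → k) :
    productForm b (vecMulVec u v) = b.equivFun.symm u * b.equivFun.symm v := by
  simp [productForm, Basis.equivFun_symm_apply, Finset.sum_mul_sum, vecMulVec_apply, smul_smul,
    mul_comm]

theorem productForm_surjective (b : Basis (Fin n) k K) : Function.Surjective (productForm b) :=
  fun x => ⟨vecMulVec (b.equivFun x) (b.equivFun 1), by simp [productForm_vecMulVec]⟩

theorem two_le_rank_of_productForm_eq_zero (b : Basis (Fin n) k K) {A : Matrix (Fin n) (Fin n) k}
    (hA : productForm b A = 0) (hA₀ : A ≠ 0) : 2 ≤ A.rank := by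
  by_contra! h
  obtain ⟨u, v, rfl⟩ := exists_eq_vecMulVec_of_rank_le_one (Nat.le_of_lt_succ h)
  rw [productForm_vecMulVec, mul_eq_zero, LinearEquiv.map_eq_zero_iff,
    LinearEquiv.map_eq_zero_iff] at hA
  rcases hA with rfl | rfl <;> simp at hA₀

theorem finrank_ker_productForm (b : Basis (Fin n) k K) :
    finrank k (LinearMap.ker (productForm b)) = n * n - n := by
  have : FiniteDimensional k K := Module.Finite.of_basis b
  have h := LinearMap.finrank_range_add_finrank_ker (productForm b)
  rw [LinearMap.range_eq_top.2 (productForm_surjective b), finrank_top,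
    Module.finrank_eq_card_basis b, Module.finrank_matrix, Fintype.card_fin, finrank_self] at h
  omega

theorem finrank_ker_vecMulLinear (A : Matrix (Fin m) (Fin n) k) :
    finrank k (LinearMap.ker A.vecMulLinear) + A.rank = m := by
  have h := LinearMap.finrank_range_add_finrank_ker A.vecMulLinear
  rw [← mulVecLin_transpose] at h ⊢
  rw [← rank_transpose A, Matrix.rank, add_comm, h, Module.finrank_fin_fun]

end RankTwo

/-! ### A parallelism of the projective space of dimension three over the field with two elements -/

/-- Two points on each line of a parallelism of the binary projective space of dimension three,
where points are written in binary and each row lists a spread. -/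
def kirkmanTable : Fin 7 → Fin 5 → ℕ × ℕ :=
  ![![(1, 2), (4, 8), (5, 10), (6, 11), (7, 9)],
    ![(1, 4), (2, 8), (3, 13), (6, 9), (7, 11)],
    ![(1, 6), (2, 9), (3, 12), (4, 10), (5, 8)],
    ![(1, 8), (2, 12), (3, 5), (4, 11), (7, 10)],
    ![(1, 10), (2, 13), (3, 4), (5, 9), (6, 8)],
    ![(1, 12), (2, 4), (3, 9), (5, 11), (7, 8)],
    ![(1, 14), (2, 5), (3, 8), (4, 9), (6, 10)]]

/-- The bit mask of the four vectors of a line of the parallelism. -/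
def kirkmanLine (i : Fin 7) (j : Fin 5) : ℕ :=
  let a := (kirkmanTable i j).1
  let b := (kirkmanTable i j).2
  1 ||| 1 <<< a ||| 1 <<< b ||| 1 <<< (a ^^^ b)

theorem card_kirkmanLine :
    ∀ i j, (Finset.univ.filter fun x : Fin 16 => (kirkmanLine i j).testBit x).card = 4 := by
  decide +kernel

theorem testBit_kirkmanLine_xor : ∀ i j, ∀ x < 16, ∀ y < 16, (kirkmanLine i j).testBit x →
    (kirkmanLine i j).testBit y → (kirkmanLine i j).testBit (x ^^^ y) := by
  decide +kernel

theorem kirkmanLine_and_kirkmanLine :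
    ∀ i j j', j ≠ j' → kirkmanLine i j &&& kirkmanLine i j' = 1 := by
  decide +kernel

theorem kirkmanLine_injective :
    ∀ i j i' j', kirkmanLine i j = kirkmanLine i' j' → i = i' ∧ j = j' := by
  decide +kernel

theorem kirkmanLine_lt : ∀ i j, kirkmanLine i j < 2 ^ 16 := by
  decide +kernel

theorem exists_testBit_kirkmanLine : ∀ x < 16, ∀ y < 16, ∃ i j,
    (kirkmanLine i j).testBit x ∧ (kirkmanLine i j).testBit y := by
  decide +kernel

section Binary

variable {k : Type*} [Field k]

theorem eq_zero_or_eq_one_of_card_eq_two (hk : Nat.card k = 2) (c : k) : c = 0 ∨ c = 1 := by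
  have : Finite k := Nat.finite_of_card_ne_zero (by omega)
  have := Fintype.ofFinite k
  classical
  by_contra! h
  have := Finset.card_le_univ ({0, 1, c} : Finset k)
  rw [Finset.card_eq_three.2 ⟨0, 1, c, zero_ne_one, h.1.symm, h.2.symm, rfl⟩,
    ← Nat.card_eq_fintype_card, hk] at this
  omega

open Classical in
/-- The binary number whose digits are the coordinates of a binary vector. -/
noncomputable def binaryCode (x : Fin 4 → k) : ℕ := Nat.ofBits fun i => decide (x i ≠ 0)

theorem binaryCode_lt (x : Fin 4 → k) : binaryCode x < 16 := Nat.ofBits_lt_two_pow _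

theorem binaryCode_zero : binaryCode (0 : Fin 4 → k) = 0 := by
  simp [binaryCode, Nat.ofBits, Fin.foldr_succ]

open Classical in
theorem testBit_binaryCode (x : Fin 4 → k) (i : Fin 4) :
    (binaryCode x).testBit i = decide (x i ≠ 0) := by
  simp [binaryCode, Nat.testBit_ofBits_lt]

theorem binaryCode_injective (hk : Nat.card k = 2) :
    Function.Injective (binaryCode : (Fin 4 → k) → ℕ) := fun x y hxy => funext fun i => by
  have h := (testBit_binaryCode x i).symm.trans (hxy ▸ testBit_binaryCode y i)
  rw [decide_eq_decide] at h
  rcases eq_zero_or_eq_one_of_card_eq_two hk (x i) with hx | hx <;>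
    rcases eq_zero_or_eq_one_of_card_eq_two hk (y i) with hy | hy <;> simp_all

theorem binaryCode_add (hk : Nat.card k = 2) (x y : Fin 4 → k) :
    binaryCode (x + y) = binaryCode x ^^^ binaryCode y := by
  have h11 : (1 : k) + 1 = 0 := (eq_zero_or_eq_one_of_card_eq_two hk _).resolve_right (by simp)
  refine Nat.eq_of_testBit_eq fun i => ?_
  by_cases hi : i < 4
  · rw [Nat.testBit_xor, testBit_binaryCode (x + y) ⟨i, hi⟩, testBit_binaryCode x ⟨i, hi⟩,
      testBit_binaryCode y ⟨i, hi⟩, Pi.add_apply]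
    rcases eq_zero_or_eq_one_of_card_eq_two hk (x ⟨i, hi⟩) with hx | hx <;>
      rcases eq_zero_or_eq_one_of_card_eq_two hk (y ⟨i, hi⟩) with hy | hy <;> simp [hx, hy, h11]
  · rw [Nat.testBit_xor]
    simp [binaryCode, Nat.testBit_ofBits_ge _ _ (not_lt.1 hi)]

theorem exists_binaryCode_eq (hk : Nat.card k = 2) (x : Fin 16) :
    ∃ v : Fin 4 → k, binaryCode v = x := by
  have : Finite k := Nat.finite_of_card_ne_zero (by omega)
  have hbij : Function.Bijective fun v : Fin 4 → k => (⟨binaryCode v, binaryCode_lt v⟩ : Fin 16) :=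
    (Nat.bijective_iff_injective_and_card _).2
      ⟨fun v w h => binaryCode_injective hk (congrArg Fin.val h), by simp [Nat.card_fun, hk]⟩
  obtain ⟨v, hv⟩ := hbij.2 x
  exact ⟨v, congrArg Fin.val hv⟩

/-- A line of the parallelism, as a subspace of dimension two. -/
noncomputable def kirkmanSubmodule (hk : Nat.card k = 2) (l : Fin 7 × Fin 5) :
    Submodule k (Fin 4 → k) where
  carrier := {x | (kirkmanLine l.1 l.2).testBit (binaryCode x)}
  zero_mem' := by
    simp [binaryCode_zero, kirkmanLine]
  add_mem' {x y} hx hy := by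
    rw [Set.mem_ofPred_eq, binaryCode_add hk]
    exact testBit_kirkmanLine_xor _ _ _ (binaryCode_lt x) _ (binaryCode_lt y) hx hy
  smul_mem' c x hx := by
    rcases eq_zero_or_eq_one_of_card_eq_two hk c with rfl | rfl
    · simp [binaryCode_zero, kirkmanLine]
    · rwa [one_smul]

theorem mem_kirkmanSubmodule (hk : Nat.card k = 2) {l : Fin 7 × Fin 5} {x : Fin 4 → k} :
    x ∈ kirkmanSubmodule hk l ↔ (kirkmanLine l.1 l.2).testBit (binaryCode x) := Iff.rfl

theorem finrank_kirkmanSubmodule (hk : Nat.card k = 2) (l : Fin 7 × Fin 5) :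
    finrank k (kirkmanSubmodule hk l) = 2 := by
  have hcard : Nat.card (kirkmanSubmodule hk l) = 4 := by
    refine Eq.trans ?_ (card_kirkmanLine l.1 l.2)
    rw [← Fintype.card_subtype, ← Nat.card_eq_fintype_card]
    refine Nat.card_congr (Equiv.ofBijective
      (fun x => ⟨⟨binaryCode x.1, binaryCode_lt x.1⟩, x.2⟩) ⟨fun x y h => ?_, fun x => ?_⟩)
    · exact Subtype.ext (binaryCode_injective hk (congrArg (fun z => z.1.1) h))
    · obtain ⟨v, hv⟩ := exists_binaryCode_eq hk x.1
      exact ⟨⟨v, by rw [mem_kirkmanSubmodule, hv]; exact x.2⟩,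
        Subtype.ext (Fin.ext hv)⟩
  rw [Module.natCard_eq_pow_finrank (K := k), hk] at hcard
  exact Nat.pow_right_injective le_rfl (hcard.trans (by norm_num : 4 = 2 ^ 2))

theorem disjoint_kirkmanSubmodule (hk : Nat.card k = 2) (i : Fin 7) {j j' : Fin 5} (h : j ≠ j') :
    Disjoint (kirkmanSubmodule hk (i, j)) (kirkmanSubmodule hk (i, j')) := by
  refine Submodule.disjoint_def.2 fun x hx hx' => binaryCode_injective hk ?_
  have h1 : (1 : ℕ).testBit (binaryCode x) := by
    rw [← kirkmanLine_and_kirkmanLine i j j' h, Nat.testBit_and]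
    exact Bool.and_eq_true_iff.2 ⟨hx, hx'⟩
  rw [binaryCode_zero]
  exact Nat.testBit_one_eq_true_iff_self_eq_zero.1 h1

theorem kirkmanSubmodule_injective (hk : Nat.card k = 2) :
    Function.Injective (kirkmanSubmodule hk) := by
  rintro ⟨i, j⟩ ⟨i', j'⟩ h
  refine Prod.ext_iff.2 (kirkmanLine_injective _ _ _ _ (Nat.eq_of_testBit_eq fun n => ?_))
  by_cases hn : n < 16
  · obtain ⟨v, hv⟩ := exists_binaryCode_eq hk ⟨n, hn⟩
    rw [Bool.eq_iff_iff]
    have := SetLike.ext_iff.1 h v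
    rwa [mem_kirkmanSubmodule, mem_kirkmanSubmodule, hv] at this
  · have hle := Nat.pow_le_pow_right two_pos (not_lt.1 hn)
    rw [Nat.testBit_lt_two_pow ((kirkmanLine_lt i j).trans_le hle),
      Nat.testBit_lt_two_pow ((kirkmanLine_lt i' j').trans_le hle)]

theorem exists_kirkmanSubmodule_eq (hk : Nat.card k = 2) {P : Submodule k (Fin 4 → k)}
    (hP : finrank k P = 2) : ∃ l, kirkmanSubmodule hk l = P := by
  let b := Module.finBasisOfFinrankEq k P hP
  obtain ⟨i, j, h₀, h₁⟩ := exists_testBit_kirkmanLine _ (binaryCode_lt (b 0 : Fin 4 → k))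
    _ (binaryCode_lt (b 1 : Fin 4 → k))
  refine ⟨(i, j), (Submodule.eq_of_le_of_finrank_eq ?_
    (hP.trans (finrank_kirkmanSubmodule hk _).symm)).symm⟩
  have hspan : P = Submodule.span k (Set.range fun t => (b t : Fin 4 → k)) := by
    have := congrArg (Submodule.map P.subtype) b.span_eq
    rw [Submodule.map_span, ← Set.range_comp, Submodule.map_top, Submodule.range_subtype] at this
    exact this.symm
  rw [hspan, Submodule.span_le]
  rintro _ ⟨t, rfl⟩
  fin_cases t
  exacts [h₀, h₁]

theorem natCard_submodule_finrank_two (hk : Nat.card k = 2) :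
    Nat.card {P : Submodule k (Fin 4 → k) // finrank k P = 2} = 35 := by
  rw [← Nat.card_congr (Equiv.ofBijective
    (fun l => (⟨kirkmanSubmodule hk l, finrank_kirkmanSubmodule hk l⟩ :
      {P : Submodule k (Fin 4 → k) // finrank k P = 2}))
    ⟨fun l l' h => kirkmanSubmodule_injective hk (congrArg Subtype.val h), fun P => by
      obtain ⟨l, hl⟩ := exists_kirkmanSubmodule_eq hk P.2
      exact ⟨l, Subtype.ext hl⟩⟩)]
  simp

theorem finrank_kirkmanSubmodule_inf_le_one (hk : Nat.card k = 2) {l l' : Fin 7 × Fin 5}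
    (h : l ≠ l') : finrank k (kirkmanSubmodule hk l ⊓ kirkmanSubmodule hk l' :
      Submodule k (Fin 4 → k)) ≤ 1 := by
  have hlt : kirkmanSubmodule hk l ⊓ kirkmanSubmodule hk l' < kirkmanSubmodule hk l := by
    refine lt_of_le_of_ne inf_le_left fun heq => h (kirkmanSubmodule_injective hk ?_)
    exact Submodule.eq_of_le_of_finrank_eq (inf_eq_left.1 heq) (by
      rw [finrank_kirkmanSubmodule, finrank_kirkmanSubmodule])
  have := Submodule.finrank_lt_finrank_of_lt hlt
  rw [finrank_kirkmanSubmodule] at this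
  omega

end Binary

/-! ### The code -/

section Code

variable {k : Type*} [Field k]

theorem finrank_sheet_vecMulLinear_inf {m n r : ℕ} {A A' : Matrix (Fin m) (Fin n) k}
    (h : r ≤ (A - A').rank) :
    finrank k (sheet ⊤ ⊥ A.vecMulLinear ⊓ sheet ⊤ ⊥ A'.vecMulLinear :
      Submodule k ((Fin m → k) × (Fin n → k))) ≤ m - r := by
  refine (finrank_sheet_inf_sheet_le _ _ _ _ _ _).trans ?_
  have hsub : A.vecMulLinear - A'.vecMulLinear = (A - A').vecMulLinear :=
    LinearMap.ext fun x => by simp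
  have := finrank_ker_vecMulLinear (A - A')
  rw [hsub, inf_idem, inf_idem, sup_idem, top_inf_eq, Submodule.comap_bot, finrank_bot]
  omega

/-- The spaces of the code: the lifted matrices, the space at infinity, and the spaces that project
onto a line of the parallelism and meet infinity in a line of the same spread. -/
noncomputable def codeSheet {K : Type*} (hk : Nat.card k = 2)
    (C : Submodule k (Matrix (Fin 4) (Fin 4) k))
    (f : Fin 7 × Fin 5 → Fin 7 × Fin 5 → K → (Fin 4 → k) →ₗ[k] (Fin 4 → k)) :
    C ⊕ Option (Fin 7 × Fin 5 × Fin 5 × K) → Submodule k ((Fin 4 → k) × (Fin 4 → k))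
  | .inl A => sheet ⊤ ⊥ A.1.vecMulLinear
  | .inr none => sheet ⊥ ⊤ 0
  | .inr (some (i, j, j', t)) =>
    sheet (kirkmanSubmodule hk (i, j)) (kirkmanSubmodule hk (i, j')) (f (i, j) (i, j') t)

variable {K : Type*} (hk : Nat.card k = 2) {C : Submodule k (Matrix (Fin 4) (Fin 4) k)}
  {f : Fin 7 × Fin 5 → Fin 7 × Fin 5 → K → (Fin 4 → k) →ₗ[k] (Fin 4 → k)}

theorem finrank_codeSheet (x : C ⊕ Option (Fin 7 × Fin 5 × Fin 5 × K)) :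
    finrank k (codeSheet hk C f x) = 4 := by
  rcases x with A | _ | ⟨i, j, j', t⟩ <;> refine (finrank_sheet _ _ _).trans ?_ <;>
    simp [finrank_kirkmanSubmodule]

theorem finrank_codeSheet_some_inf_le
    (hf : ∀ l l' s t, s ≠ t →
      kirkmanSubmodule hk l ⊓ (kirkmanSubmodule hk l').comap (f l l' s - f l l' t) = ⊥)
    {x y : Fin 7 × Fin 5 × Fin 5 × K} (hxy : x ≠ y) :
    finrank k (codeSheet hk C f (.inr (some x)) ⊓ codeSheet hk C f (.inr (some y)) :
      Submodule k ((Fin 4 → k) × (Fin 4 → k))) ≤ 2 := by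
  obtain ⟨i, j, j', s⟩ := x
  obtain ⟨i₂, j₂, j₂', t⟩ := y
  have hle := finrank_sheet_inf_sheet_le_add (kirkmanSubmodule hk (i, j))
    (kirkmanSubmodule hk (i₂, j₂)) (kirkmanSubmodule hk (i, j')) (kirkmanSubmodule hk (i₂, j₂'))
    (f (i, j) (i, j') s) (f (i₂, j₂) (i₂, j₂') t)
  have hbound (l l' : Fin 7 × Fin 5) : finrank k (kirkmanSubmodule hk l ⊓ kirkmanSubmodule hk l' :
      Submodule k (Fin 4 → k)) ≤ 2 :=
    (Submodule.finrank_mono inf_le_left).trans (finrank_kirkmanSubmodule hk l).le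
  by_cases hi : i = i₂
  · subst hi
    have hdisj {a b : Fin 5} (hab : a ≠ b) : finrank k (kirkmanSubmodule hk (i, a) ⊓
        kirkmanSubmodule hk (i, b) : Submodule k (Fin 4 → k)) = 0 := by
      rw [(disjoint_kirkmanSubmodule hk i hab).eq_bot, finrank_bot]
    by_cases hj : j = j₂
    · by_cases hj' : j' = j₂'
      · subst hj hj'
        have hst : s ≠ t := fun h => hxy (by rw [h])
        refine (finrank_sheet_inf_sheet_le _ _ _ _ _ _).trans ?_
        rw [inf_idem, sup_idem, inf_idem, hf _ _ s t hst, finrank_bot, finrank_kirkmanSubmodule]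
      · have := hdisj hj'
        have := hbound (i, j) (i, j₂)
        exact hle.trans (by omega)
    · have := hdisj hj
      have := hbound (i, j') (i, j₂')
      exact hle.trans (by omega)
  · have h₁ := finrank_kirkmanSubmodule_inf_le_one hk (l := (i, j)) (l' := (i₂, j₂))
      fun h => hi (congrArg Prod.fst h)
    have h₂ := finrank_kirkmanSubmodule_inf_le_one hk (l := (i, j')) (l' := (i₂, j₂'))
      fun h => hi (congrArg Prod.fst h)
    exact hle.trans (by omega)

theorem finrank_codeSheet_inf_le (hC : ∀ A ∈ C, A ≠ 0 → 2 ≤ A.rank)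
    (hf : ∀ l l' s t, s ≠ t →
      kirkmanSubmodule hk l ⊓ (kirkmanSubmodule hk l').comap (f l l' s - f l l' t) = ⊥)
    {x y : C ⊕ Option (Fin 7 × Fin 5 × Fin 5 × K)} (hxy : x ≠ y) :
    finrank k (codeSheet hk C f x ⊓ codeSheet hk C f y :
      Submodule k ((Fin 4 → k) × (Fin 4 → k))) ≤ 2 := by
  have hlift (A : C) (z : Option (Fin 7 × Fin 5 × Fin 5 × K)) :
      finrank k (codeSheet hk C f (.inl A) ⊓ codeSheet hk C f (.inr z) :
        Submodule k ((Fin 4 → k) × (Fin 4 → k))) ≤ 2 := by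
    rcases z with _ | ⟨i, j, j', t⟩ <;>
      refine (finrank_sheet_inf_sheet_le_right_add_left _ _ _ _ _ _).trans ?_ <;>
      simp [finrank_kirkmanSubmodule]
  have hinf (z : Fin 7 × Fin 5 × Fin 5 × K) :
      finrank k (codeSheet hk C f (.inr (some z)) ⊓ codeSheet hk C f (.inr none) :
        Submodule k ((Fin 4 → k) × (Fin 4 → k))) ≤ 2 := by
    refine (finrank_sheet_inf_sheet_le_right_add_left _ _ _ _ _ _).trans ?_
    simp [finrank_kirkmanSubmodule]
  match x, y, hxy with
  | .inl A, .inl A', h =>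
    refine finrank_sheet_vecMulLinear_inf (hC _ (sub_mem A.2 A'.2) fun h₀ => h ?_)
    rw [Subtype.ext (sub_eq_zero.1 h₀)]
  | .inl A, .inr z, _ => exact hlift A z
  | .inr z, .inl A, _ => exact inf_comm (codeSheet hk C f (.inl A)) _ ▸ hlift A z
  | .inr none, .inr none, h => exact (h rfl).elim
  | .inr (some z), .inr none, _ => exact hinf z
  | .inr none, .inr (some z), _ => exact inf_comm (codeSheet hk C f (.inr (some z))) _ ▸ hinf z
  | .inr (some z), .inr (some z'), h =>
    exact finrank_codeSheet_some_inf_le hk hf fun hz => h (by rw [hz])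

end Code

section Lift

/-- Splitting a vector into its first and last four coordinates. -/
def splitEquiv (k : Type*) [Field k] : (Fin 8 → k) ≃ₗ[k] (Fin 4 → k) × (Fin 4 → k) :=
  (LinearEquiv.funCongrLeft k k (finSumFinEquiv (m := 4) (n := 4))).trans
    (LinearEquiv.sumArrowLequivProdArrow (Fin 4) (Fin 4) k k)

theorem liftSubspace_eq_comap_sheet {k : Type} [Field k] (A : Matrix (Fin 4) (Fin 4) k) :
    liftSubspace k 8 4 A =
      (sheet ⊤ ⊥ A.vecMulLinear).comap (splitEquiv k).toLinearMap := by
  have hrow (y : Fin 4 → k) : splitEquiv k (y ᵥ* liftMatrix k 8 4 A) = (y, y ᵥ* A) := by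
    refine Prod.ext (funext fun j => ?_) (funext fun j => ?_)
    · change (y ᵥ* liftMatrix k 8 4 A) (Fin.castAdd 4 j) = y j
      simp [vecMul, dotProduct, liftMatrix, ← Fin.ext_iff]
    · change (y ᵥ* liftMatrix k 8 4 A) (Fin.natAdd 4 j) = (y ᵥ* A) j
      simp [vecMul, dotProduct, liftMatrix]
  have hspan : liftSubspace k 8 4 A = LinearMap.range (liftMatrix k 8 4 A).vecMulLinear :=
    (range_vecMulLinear _).symm
  ext x
  rw [hspan, Submodule.mem_comap, mem_sheet]
  constructor
  · rintro ⟨y, rfl⟩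
    simp [hrow]
  · rintro ⟨-, hx⟩
    refine ⟨(splitEquiv k x).1, (splitEquiv k).injective ?_⟩
    rw [vecMulLinear_apply, hrow]
    exact Prod.ext rfl (sub_eq_zero.1 hx).symm

theorem ncard_le_Aq {n d k : ℕ} {S : Set (Submodule F (Fin n → F))}
    (hS : ∀ X ∈ S, finrank F X = k) (hd : ∀ X ∈ S, ∀ Y ∈ S, X ≠ Y → d ≤ subDist F X Y) :
    S.ncard ≤ Aq F n d k := by
  refine le_csSup ⟨Nat.card (Submodule F (Fin n → F)), ?_⟩ ⟨S, S.toFinite, rfl, hS, hd⟩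
  rintro _ ⟨T, -, rfl, -⟩
  exact Set.ncard_le_card T

theorem Aq_self (n d : ℕ) : Aq F n d n = 1 := by
  have hle : ∀ M ∈ {M | ∃ S : Set (Submodule F (Fin n → F)), S.Finite ∧ S.ncard = M ∧
      (∀ X ∈ S, finrank F X = n) ∧ ∀ X ∈ S, ∀ Y ∈ S, X ≠ Y → d ≤ subDist F X Y}, M ≤ 1 := by
    rintro _ ⟨S, -, rfl, hS, -⟩
    have hsub : S ⊆ {⊤} := fun X hX =>
      Submodule.eq_top_of_finrank_eq ((hS X hX).trans (Module.finrank_fin_fun F).symm)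
    exact (Set.ncard_le_ncard hsub).trans (Set.ncard_singleton _).le
  refine le_antisymm (csSup_le' hle) ?_
  rw [← Set.ncard_singleton (⊤ : Submodule F (Fin n → F))]
  refine ncard_le_Aq F (fun X hX => ?_) fun X hX Y hY h => ?_
  · rw [Set.mem_singleton_iff.1 hX, finrank_top, Module.finrank_fin_fun]
  · exact (h ((Set.mem_singleton_iff.1 hX).trans (Set.mem_singleton_iff.1 hY).symm)).elim

theorem exists_code_containing_lifted_MRD (hF : Nat.card F = 2) :
    ∃ (C : Submodule F (Matrix (Fin 4) (Fin (8 - 4)) F)) (S : Set (Submodule F (Fin 8 → F))),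
      IsMRD F 8 4 2 C ∧ liftedCode F 8 4 C ⊆ S ∧ S.Finite ∧ S.ncard = 2 ^ 12 + 701 ∧
      (∀ X ∈ S, finrank F X = 4) ∧ (∀ X ∈ S, ∀ Y ∈ S, X ≠ Y → 4 ≤ subDist F X Y) := by
  have : Fact (Nat.Prime 2) := ⟨Nat.prime_two⟩
  have : CharP F 2 := charP_of_card_eq_prime (Nat.card_eq_fintype_card.symm.trans hF)
  let K := FiniteField.Extension F 2 2
  have hK : finrank F K = 2 := FiniteField.finrank_extension F 2 2
  let b : Basis (Fin 4) F (FiniteField.Extension F 2 4) :=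
    Module.finBasisOfFinrankEq _ _ (FiniteField.finrank_extension F 2 4)
  let C : Submodule F (Matrix (Fin 4) (Fin 4) F) := LinearMap.ker (productForm b)
  have hC_finrank : finrank F C = 12 := finrank_ker_productForm b
  have hC : ∀ A ∈ C, A ≠ 0 → 2 ≤ A.rank := fun A hA =>
    two_le_rank_of_productForm_eq_zero b (LinearMap.mem_ker.1 hA)
  have hmaps (l l' : Fin 7 × Fin 5) := exists_maps_inf_comap_sub_eq_bot K
    (A := kirkmanSubmodule hF l) (B := kirkmanSubmodule hF l')
    ((finrank_kirkmanSubmodule hF l).trans hK.symm)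
    (by rw [finrank_kirkmanSubmodule, hK, Module.finrank_fin_fun])
  choose f hf using hmaps
  let X := fun x => (codeSheet hF C f x).comap (splitEquiv F).toLinearMap
  have hmap (P : Submodule F ((Fin 4 → F) × (Fin 4 → F))) :
      finrank F (P.comap (splitEquiv F).toLinearMap) = finrank F P := by
    exact (congrArg (fun Q : Submodule F (Fin 8 → F) => finrank F Q)
      (Submodule.map_equiv_eq_comap_symm (splitEquiv F).symm P).symm).trans
      (LinearEquiv.finrank_map_eq _ _)
  have hX (x) : finrank F (X x) = 4 := (hmap _).trans (finrank_codeSheet hF x)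
  have hXX {x y} (h : x ≠ y) : finrank F (X x ⊓ X y : Submodule F (Fin 8 → F)) ≤ 2 := by
    rw [← Submodule.comap_inf, hmap]
    exact finrank_codeSheet_inf_le hF hC hf h
  have hX_inj : Function.Injective X := fun x y h => by
    by_contra hxy
    have h₂ := hXX hxy
    rw [h, inf_idem, hX] at h₂
    omega
  refine ⟨C, Set.range X, ⟨hC_finrank, hC⟩, ?_, Set.toFinite _, ?_, ?_, ?_⟩
  · rintro _ ⟨A, hA, rfl⟩
    exact ⟨.inl ⟨A, hA⟩, (liftSubspace_eq_comap_sheet A).symm⟩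
  · have : Finite K := Module.finite_of_finite F
    rw [Set.ncard_range_of_injective hX_inj, Nat.card_sum, Finite.card_option, Nat.card_prod,
      Nat.card_prod, Nat.card_prod, Module.natCard_eq_pow_finrank (K := F) (V := C),
      Module.natCard_eq_pow_finrank (K := F) (V := K), hF, hC_finrank, hK]
    simp
  · rintro _ ⟨x, rfl⟩
    exact hX x
  · rintro _ ⟨x, rfl⟩ _ ⟨y, rfl⟩ h
    have h₂ := hXX fun hxy => h (congrArg X hxy)
    rw [subDist, hX, hX]
    omega

end Lift

/-- (Construction III.) There exists an `(8, 2¹² + 701, 4, 4)_2` constant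
dimension code containing an `(8,4,2)_2` lifted MRD code; in particular `A_2(8,4,4) ≥ 4797`,
and this size attains the upper bound
`q^{(n-2k)(k+1)} + Gauss[n-2k,k]_q (q^n - q^{n-2k})/(q^{2k} - q^k) + A_q(n-2k,2k,2k)`
at `q = 2`, `n = 8`, `k = 2`. -/
theorem stmt14 (hq : Fintype.card F = 2) :
    (∃ (C : Submodule F (Matrix (Fin 4) (Fin (8 - 4)) F))
      (S : Set (Submodule F (Fin 8 → F))),
      IsMRD F 8 4 2 C ∧ liftedCode F 8 4 C ⊆ S ∧ S.Finite ∧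
      S.ncard = 2 ^ 12 + 701 ∧
      (∀ X ∈ S, finrank F X = 4) ∧
      (∀ X ∈ S, ∀ Y ∈ S, X ≠ Y → 4 ≤ subDist F X Y)) ∧
    2 ^ 12 + 701 ≤ Aq F 8 4 4 ∧
    2 ^ 12 + 701 = 2 ^ ((8 - 2 * 2) * (2 + 1)) +
      gaussNat F (8 - 2 * 2) 2 * ((2 ^ 8 - 2 ^ (8 - 2 * 2)) / (2 ^ (2 * 2) - 2 ^ 2)) +
      Aq F (8 - 2 * 2) (2 * 2) (2 * 2) := by
  have hF : Nat.card F = 2 := Nat.card_eq_fintype_card.trans hq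
  obtain ⟨C, S, hC, hCS, hfin, hcard, hS, hd⟩ := exists_code_containing_lifted_MRD F hF
  refine ⟨⟨C, S, hC, hCS, hfin, hcard, hS, hd⟩, hcard ▸ ncard_le_Aq F hS hd, ?_⟩
  rw [Aq_self F 4 4, gaussNat, natCard_submodule_finrank_two hF]
  norm_num
end

section
/- Let q be a prime power, let n, k, δ be integers with 1 < k ≤ n−k and 1 ≤ δ ≤ k−1, let C^MRD be an (n,k,δ)_q lifted MRD code, let H be its point–block incidence matrix over 𝔽_2, and let C be the binary linear code of length |V^n| = (q^k−1)q^{n−k}/(q−1) with parity-check matrix H (the null space of H over 𝔽_2). Then every nonzero codeword of C has Hamming weight at least q^{n−k}(q^k−1)/(q^k−q); i.e., the minimum distance d of C satisfies d ≥ q^{n−k}(q^k−1)/(q^k−q). -/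
open Module Polynomial Matrix

variable (F : Type) [Field F] [Fintype F]

noncomputable instance (n k : ℕ) : Fintype {P : Submodule F (Fin n → F) // P ∈ Vset F n k} :=
  Fintype.ofFinite _

noncomputable instance (n k : ℕ) (C : Submodule F (Matrix (Fin k) (Fin (n - k)) F)) :
    Fintype {X : Submodule F (Fin n → F) // X ∈ liftedCode F n k C} :=
  Fintype.ofFinite _

noncomputable instance (n k : ℕ) : DecidableEq {P : Submodule F (Fin n → F) // P ∈ Vset F n k} :=
  Classical.decEq _

open scoped Classical in
/-- The point–block incidence matrix `H` of a lifted MRD code: rows are indexed by the codewords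
`X` of the lifted code, columns by the points `P ∈ V^n`, and `H_{X,P} = 1` iff `P ⊆ X`;
entries taken in a commutative ring `R`. -/
noncomputable def incidence (R : Type) [CommRing R] (n k : ℕ)
    (C : Submodule F (Matrix (Fin k) (Fin (n - k)) F)) :
    Matrix {X : Submodule F (Fin n → F) // X ∈ liftedCode F n k C}
           {P : Submodule F (Fin n → F) // P ∈ Vset F n k} R :=
  Matrix.of fun X P =>
    if (P : Submodule F (Fin n → F)) ≤ (X : Submodule F (Fin n → F)) then 1 else 0

/-- The first `k` coordinates of a vector. -/
def leftPart {n k : ℕ} (h : k ≤ n) : (Fin n → F) →ₗ[F] (Fin k → F) :=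
  LinearMap.funLeft F F (Fin.castLE h)

/-- The last `n - k` coordinates of a vector. -/
def rightPart {n k : ℕ} (h : k ≤ n) : (Fin n → F) →ₗ[F] (Fin (n - k) → F) :=
  LinearMap.funLeft F F fun j => ⟨k + j, by have := j.isLt; omega⟩

theorem vecMul_liftMatrix_eq_iff {n k : ℕ} (h : k ≤ n) (A : Matrix (Fin k) (Fin (n - k)) F)
    (c : Fin k → F) (v : Fin n → F) :
    c ᵥ* liftMatrix F n k A = v ↔ c = leftPart F h v ∧ c ᵥ* A = rightPart F h v := by
  have hl : leftPart F h (c ᵥ* liftMatrix F n k A) = c := by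
    ext i
    simp [leftPart, LinearMap.funLeft, liftMatrix, vecMul, dotProduct, Fin.val_inj]
  have hr : rightPart F h (c ᵥ* liftMatrix F n k A) = c ᵥ* A := by
    ext i
    simp [rightPart, LinearMap.funLeft, liftMatrix, vecMul, dotProduct]
  constructor
  · rintro rfl
    exact ⟨hl.symm, hr.symm⟩
  · rintro ⟨h1, h2⟩
    ext j
    by_cases hj : (j : ℕ) < k
    · exact congrFun (hl.trans h1) ⟨j, hj⟩
    · have := congrFun (hr.trans h2) ⟨j - k, by have := j.isLt; omega⟩
      have hj' : (⟨k + (j - k), by have := j.isLt; omega⟩ : Fin n) = j :=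
        Fin.ext (by simp; omega)
      simpa [rightPart, LinearMap.funLeft, hj'] using this

theorem mem_liftSubspace_iff {n k : ℕ} (h : k ≤ n) (A : Matrix (Fin k) (Fin (n - k)) F)
    (v : Fin n → F) :
    v ∈ liftSubspace F n k A ↔ leftPart F h v ᵥ* A = rightPart F h v := by
  have : liftSubspace F n k A = LinearMap.range (liftMatrix F n k A).vecMulLinear :=
    (_root_.range_vecMulLinear _).symm
  rw [this, LinearMap.mem_range]
  simp only [Matrix.vecMulLinear_apply, vecMul_liftMatrix_eq_iff F h]
  exact ⟨fun ⟨c, hc, hA⟩ => hc ▸ hA, fun hA => ⟨_, rfl, hA⟩⟩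

theorem exists_linearIndependent_extend_pair {k : ℕ} {u u' : Fin k → F}
    (hu : LinearIndependent F ![u, u']) {r : ℕ} (h2 : 2 ≤ r) (hr : r ≤ k) :
    ∃ b : Fin r → Fin k → F, LinearIndependent F b ∧ u ∈ Set.range b ∧ u' ∈ Set.range b := by
  induction r, h2 using Nat.le_induction with
  | base => exact ⟨_, hu, ⟨0, rfl⟩, ⟨1, rfl⟩⟩
  | succ r _ ih =>
    obtain ⟨b, hb, ⟨i, hi⟩, ⟨j, hj⟩⟩ := ih (by omega)
    obtain ⟨y, hy⟩ := exists_linearIndependent_snoc_of_lt_finrank hb (by simp; omega)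
    exact ⟨_, hy, ⟨i.castSucc, by simpa using hi⟩, ⟨j.castSucc, by simpa using hj⟩⟩

/-- Evaluation of the matrices of a code at a row vector. -/
def evalAt {k m : ℕ} (C : Submodule F (Matrix (Fin k) (Fin m) F)) (u : Fin k → F) :
    C →ₗ[F] (Fin m → F) where
  toFun A := u ᵥ* A.1
  map_add' _ _ := Matrix.vecMul_add _ _ _
  map_smul' _ _ := Matrix.vecMul_smul _ _ _

/-- Evaluation of an MRD code with `δ < k` at two independent vectors is onto. -/
theorem IsMRD.evalAt_prod_surjective {n k δ : ℕ} (hδ1 : 1 ≤ δ) (hδk : δ + 1 ≤ k)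
    {C : Submodule F (Matrix (Fin k) (Fin (n - k)) F)} (hC : IsMRD F n k δ C)
    {u u' : Fin k → F} (hu : LinearIndependent F ![u, u']) :
    Function.Surjective ((evalAt F C u).prod (evalAt F C u')) := by
  obtain ⟨b, hb, ⟨i, rfl⟩, ⟨j, rfl⟩⟩ := exists_linearIndependent_extend_pair F hu
    (r := k - δ + 1) (by omega) (by omega)
  have hij : i ≠ j := by
    rintro rfl
    exact absurd (hu.injective (a₁ := 0) (a₂ := 1) rfl) (by decide)
  let Φ : C →ₗ[F] (Fin (k - δ + 1) → Fin (n - k) → F) := LinearMap.pi fun i => evalAt F C (b i)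
  have hinj : Function.Injective Φ := by
    rw [injective_iff_map_eq_zero]
    intro A hA
    by_contra hne
    have hmul : Matrix.of b * A.1 = 0 := by
      ext i j
      exact congrFun (congrFun hA i) j
    have h1 := Matrix.rank_add_rank_le_card_of_mul_eq_zero hmul
    have h2 : (Matrix.of b).rank = k - δ + 1 := by
      simpa using LinearIndependent.rank_matrix (M := Matrix.of b) hb
    have h3 := hC.2 A.1 A.2 (by simpa using hne)
    rw [Fintype.card_fin] at h1
    omega
  have hdim : finrank F C = finrank F (Fin (k - δ + 1) → Fin (n - k) → F) := by
    rw [hC.1, Module.finrank_pi_fintype]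
    simp [mul_comm]
  have hsurj := (LinearMap.injective_iff_surjective_of_finrank_eq_finrank hdim).1 hinj
  rintro ⟨w, w'⟩
  obtain ⟨A, hA⟩ := hsurj (Function.update (fun _ => w') i w)
  refine ⟨A, Prod.ext ?_ ?_⟩
  · exact (congrFun hA i).trans (by simp)
  · exact (congrFun hA j).trans (by simp [hij.symm])

theorem card_fiber_mul_card_of_surjective {V W : Type*} [AddCommGroup V] [AddCommGroup W]
    [Fintype V] [Fintype W] [DecidableEq W] (f : V →+ W) (hf : Function.Surjective f) (w : W) :
    Finset.card {v | f v = w} * Fintype.card W = Fintype.card V := by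
  have h : ∀ w' : W, Finset.card {v | f v = w'} = Finset.card {v | f v = w} := fun w' =>
    AddMonoidHom.card_fiber_eq_of_mem_range f (hf w') (hf w)
  rw [← Finset.card_univ (α := V),
    Finset.card_eq_sum_card_fiberwise (s := Finset.univ) (f := f) (t := Finset.univ) (by simp),
    Finset.sum_congr rfl fun w' _ => h w']
  simp [mul_comm]

open scoped Classical in
/-- If each point of `S` sees at least `Q` points of `S` outside its own class, then averaging
over the classes bounds `Q`. -/
theorem mul_card_add_card_le {P G : Type*} [Fintype G] (S : Finset P) (hS : S.Nonempty)
    (g : P → G) (Q : ℕ) (h : ∀ p ∈ S, Q ≤ Finset.card {p' ∈ S | g p' ≠ g p}) :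
    Q * Fintype.card G + S.card ≤ S.card * Fintype.card G := by
  obtain ⟨p, hp, hmax⟩ : ∃ p ∈ S, S.card ≤
      Fintype.card G * Finset.card {p' ∈ S | g p' = g p} := by
    by_contra! hcon
    obtain ⟨p₀, hp₀⟩ := hS
    have hall : ∀ y : G, Fintype.card G * Finset.card {p' ∈ S | g p' = y} < S.card := by
      intro y
      by_cases hy : ∃ p ∈ S, g p = y
      · obtain ⟨p, hp, rfl⟩ := hy
        exact hcon p hp
      · push Not at hy
        rw [Finset.filter_eq_empty_iff.2 hy]
        simpa using ⟨p₀, hp₀⟩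
    have hlt := Finset.sum_lt_sum_of_nonempty (s := Finset.univ) ⟨g p₀, Finset.mem_univ _⟩
      fun y _ => hall y
    rw [← Finset.mul_sum, ← Finset.card_eq_sum_card_fiberwise (f := g) (by simp)] at hlt
    simp at hlt
  have hsplit := Finset.card_filter_add_card_filter_not (s := S) (fun p' => g p' = g p)
  have hQ := h p hp
  nlinarith [Nat.mul_le_mul_right (Fintype.card G) hQ]

open scoped Classical in
/-- A set of vectors with nonzero left part such that every codeword through one of them passes
through another one, with a different left direction, has at least `q ^ (n - k)` elements whose
left direction differs from that of a given element. -/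
theorem IsMRD.card_pow_le {n k δ : ℕ} (hδ1 : 1 ≤ δ) (hδk : δ + 1 ≤ k)
    {C : Submodule F (Matrix (Fin k) (Fin (n - k)) F)} (hC : IsMRD F n k δ C)
    {P : Type*} (T : Finset P) (l : P → Fin k → F) (r : P → Fin (n - k) → F)
    (u : Fin k → F) (w : Fin (n - k) → F)
    (hind : ∀ p ∈ T, LinearIndependent F ![u, l p]) (hu : u ≠ 0)
    (hcover : ∀ A ∈ C, u ᵥ* A = w → ∃ p ∈ T, l p ᵥ* A = r p) :
    Fintype.card F ^ (n - k) ≤ T.card := by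
  have hfib : ∀ p ∈ T, Finset.card {A : C | ((evalAt F C u).prod (evalAt F C (l p))) A = (w, r p)} *
      (Fintype.card F ^ (n - k) * Fintype.card F ^ (n - k)) = Fintype.card C := fun p hp => by
    have := card_fiber_mul_card_of_surjective
      ((evalAt F C u).prod (evalAt F C (l p))).toAddMonoidHom
      (hC.evalAt_prod_surjective F hδ1 hδk (hind p hp)) (w, r p)
    simpa using this
  have hsub : ({A : C | evalAt F C u A = w} : Finset C) ⊆ T.biUnion fun p =>
      {A : C | ((evalAt F C u).prod (evalAt F C (l p))) A = (w, r p)} := by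
    intro A hA
    simp only [Finset.mem_filter, Finset.mem_univ, true_and] at hA
    obtain ⟨p, hp, hpA⟩ := hcover A.1 A.2 hA
    simp only [Finset.mem_biUnion, Finset.mem_filter, Finset.mem_univ, true_and]
    exact ⟨p, hp, Prod.ext hA hpA⟩
  obtain ⟨y, hy⟩ := exists_linearIndependent_snoc_of_lt_finrank (R := F) (v := ![u])
    (by simpa using hu) (by simp; omega)
  have hsnoc : (Fin.snoc ![u] y : Fin 2 → Fin k → F) = ![u, y] := by
    ext i
    fin_cases i <;> rfl
  rw [hsnoc] at hy
  have hsurj : Function.Surjective (evalAt F C u) := fun z => by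
    obtain ⟨A, hA⟩ := hC.evalAt_prod_surjective F hδ1 hδk hy (z, 0)
    exact ⟨A, congrArg Prod.fst hA⟩
  have hone := card_fiber_mul_card_of_surjective (evalAt F C u).toAddMonoidHom hsurj w
  have hle := (Finset.card_le_card hsub).trans Finset.card_biUnion_le
  have hmul := Nat.mul_le_mul_right (Fintype.card F ^ (n - k) * Fintype.card F ^ (n - k)) hle
  rw [Finset.sum_mul, Finset.sum_congr rfl hfib, Finset.sum_const, smul_eq_mul] at hmul
  have hone' : Finset.card {A : C | evalAt F C u A = w} * Fintype.card F ^ (n - k) =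
      Fintype.card C := by
    rw [Fintype.card_fun, Fintype.card_fin] at hone
    convert hone
    rfl
  rw [← mul_assoc, hone', mul_comm] at hmul
  exact Nat.le_of_mul_le_mul_right hmul Fintype.card_pos

/-- If a parity check is satisfied, a block through a point of the support of a codeword contains
another point of the support. -/
theorem exists_ne_mem_support {n k : ℕ} {C : Submodule F (Matrix (Fin k) (Fin (n - k)) F)}
    {x : {P : Submodule F (Fin n → F) // P ∈ Vset F n k} → ZMod 2}
    (hx : (incidence F (ZMod 2) n k C).mulVec x = 0)
    {A : Matrix (Fin k) (Fin (n - k)) F} (hA : A ∈ C)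
    {p : {P : Submodule F (Fin n → F) // P ∈ Vset F n k}} (hp : x p ≠ 0)
    (hpA : p.1 ≤ liftSubspace F n k A) :
    ∃ p', p' ≠ p ∧ x p' ≠ 0 ∧ p'.1 ≤ liftSubspace F n k A := by
  by_contra! hcon
  have hrow := congrFun hx ⟨liftSubspace F n k A, A, hA, rfl⟩
  rw [Matrix.mulVec, dotProduct, Finset.sum_eq_single p] at hrow
  · simp [incidence, hpA] at hrow
    exact hp hrow
  · intro p' _ hne
    by_cases hx' : x p' = 0
    · simp [hx']
    · simp [incidence, hcon p' hne hx']
  · simp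

/-- (Tanner bound.) Every nonzero codeword `x` of the binary code with
parity-check matrix `H` (the incidence matrix of an `(n,k,δ)_q` lifted MRD code) has Hamming
weight at least `q^{n-k}(q^k - 1)/(q^k - q)`. -/
theorem stmt17 (q n k δ : ℕ) (hq : Fintype.card F = q)
    (hk : 1 < k) (hkn : k ≤ n - k) (hδ1 : 1 ≤ δ) (hδk : δ ≤ k - 1)
    (C : Submodule F (Matrix (Fin k) (Fin (n - k)) F)) (hC : IsMRD F n k δ C)
    (x : {P : Submodule F (Fin n → F) // P ∈ Vset F n k} → ZMod 2)
    (hx : (incidence F (ZMod 2) n k C).mulVec x = 0) (hx0 : x ≠ 0) :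
    ((q : ℚ) ^ (n - k) * ((q : ℚ) ^ k - 1)) / ((q : ℚ) ^ k - (q : ℚ)) ≤
      ({i | x i ≠ 0}.ncard : ℚ) := by
  classical
  subst hq
  have hkn' : k ≤ n := by omega
  choose v hvL hv using fun p : {P : Submodule F (Fin n → F) // P ∈ Vset F n k} => p.2
  have hne : ∀ p, leftPart F hkn' (v p) ≠ 0 := by
    intro p h0
    obtain ⟨i, hi, hvi⟩ := hvL p
    exact hvi (congrFun h0 ⟨i, hi⟩)
  have hle : ∀ p A, p.1 ≤ liftSubspace F n k A ↔
      leftPart F hkn' (v p) ᵥ* A = rightPart F hkn' (v p) := by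
    intro p A
    rw [hv p, Submodule.span_singleton_le_iff_mem, mem_liftSubspace_iff F hkn']
  let g := fun p => Projectivization.mk F _ (hne p)
  have hgroup : ∀ p p' A, p.1 ≤ liftSubspace F n k A → p'.1 ≤ liftSubspace F n k A →
      g p' = g p → p' = p := by
    intro p p' A h1 h2 h
    rw [hle] at h1 h2
    obtain ⟨a, ha⟩ := (Projectivization.mk_eq_mk_iff F _ _ _ _).1 h
    have hl : leftPart F hkn' (v p') = leftPart F hkn' (a • v p) := by
      rw [← ha]; rfl
    have hr : rightPart F hkn' (v p') = rightPart F hkn' (a • v p) := by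
      rw [← h2, hl]
      change (a.1 • leftPart F hkn' (v p)) ᵥ* A = a.1 • rightPart F hkn' (v p)
      rw [Matrix.smul_vecMul, h1]
    have hvv : v p' = a • v p := by
      have h3 := (vecMul_liftMatrix_eq_iff F hkn' A _ (v p')).2 ⟨rfl, h2⟩
      have h4 := (vecMul_liftMatrix_eq_iff F hkn' A _ (a • v p)).2 ⟨hl, by rw [h2, hr]⟩
      exact h3.symm.trans h4
    exact Subtype.ext (by
      rw [hv p', hv p, hvv]
      exact Submodule.span_singleton_group_smul_eq F a (v p))
  let S : Finset {P : Submodule F (Fin n → F) // P ∈ Vset F n k} := {p | x p ≠ 0}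
  have hS : S.Nonempty := by
    obtain ⟨p, hp⟩ := Function.ne_iff.1 hx0
    exact ⟨p, by simpa [S] using hp⟩
  have : Fintype (Projectivization F (Fin k → F)) := Fintype.ofFinite _
  have key := mul_card_add_card_le S hS g (Fintype.card F ^ (n - k)) (by
    intro p hp
    refine hC.card_pow_le F hδ1 (by omega) _ (fun p => leftPart F hkn' (v p))
      (fun p => rightPart F hkn' (v p)) (leftPart F hkn' (v p)) (rightPart F hkn' (v p))
      ?_ (hne p) ?_
    · intro p' hp'
      have hgg := (Finset.mem_filter.1 hp').2.symm
      rwa [← Projectivization.independent_pair_iff_ne,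
        Projectivization.independent_mk_iff_LinearIndependent] at hgg
    · intro A hA hpA
      obtain ⟨p', hp', hxp', hAp'⟩ :=
        exists_ne_mem_support F hx hA (by simpa [S] using hp) ((hle p A).2 hpA)
      exact ⟨p', Finset.mem_filter.2 ⟨by simpa [S] using hxp',
        fun h => hp' (hgroup p p' A ((hle p A).2 hpA) hAp' h)⟩, (hle p' A).1 hAp'⟩)
  have hcard := Projectivization.card' F (Fin k → F)
  have hncard : {i | x i ≠ 0}.ncard = S.card := by
    rw [← Set.ncard_coe_finset]; simp [S]
  rw [hncard]
  simp only [Nat.card_eq_fintype_card, Fintype.card_fun, Fintype.card_fin] at hcard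
  have hq1 : 1 < Fintype.card F := Fintype.one_lt_card
  have hqk : Fintype.card F < Fintype.card F ^ k := by
    simpa using Nat.pow_lt_pow_right hq1 hk
  generalize Fintype.card (Projectivization F (Fin k → F)) = N at key hcard
  generalize Fintype.card F = q at *
  have hcardQ : (q : ℚ) ^ k = N * (q - 1) + 1 := by
    have := congrArg (Nat.cast (R := ℚ)) hcard
    push_cast [Nat.cast_sub hq1.le] at this
    exact this
  have keyQ : (q : ℚ) ^ (n - k) * N + S.card ≤ S.card * N := by exact_mod_cast key
  have hq1Q : (1 : ℚ) < q := by exact_mod_cast hq1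
  have hqkQ : (q : ℚ) < (q : ℚ) ^ k := by exact_mod_cast hqk
  rw [div_le_iff₀ (by linarith), hcardQ]
  nlinarith [mul_le_mul_of_nonneg_right keyQ (by linarith : (0 : ℚ) ≤ q - 1)]
end
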